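/- arXiv:1911.04594 — 2 statements merged into one kernel-verified Lean document; each statement's English description precedes it below -/
import Mathlib

section
/- Let Z be a measurable space, let μ_1, …, μ_N be probability measures on Z (the encoder distributions q(z|x_n) for the N training examples), let p be a probability measure on Z (the prior), and let μ̄ = (1/N) ∑_{n=1}^N μ_n be their uniform mixture (the aggregate/inference marginal q(z)). Assume each μ_n is absolutely continuous with respect to p and that KL(μ_n ‖ p) is finite for every n. Then the rate decomposes as (1/N) ∑_{n=1}^N KL(μ_n ‖ p) = (1/N) ∑_{n=1}^N KL(μ_n ‖ μ̄) + KL(μ̄ ‖ p); that is, the average KL divergence of the encoder distributions from the prior equals the mutual information term plus the KL divergence of the aggregate posterior from the prior. -/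
open MeasureTheory Real
open scoped ENNReal

open Classical in
/-- Kullback–Leibler divergence of `μ` from `ν`, valued in `EReal`, taken to be `⊤`
when `μ` is not absolutely continuous with respect to `ν` (or when the log-likelihood
ratio is not integrable). -/
noncomputable def KL {Z : Type*} [MeasurableSpace Z] (μ ν : Measure Z) : EReal :=
  if μ ≪ ν ∧ Integrable (llr μ ν) μ then ((∫ z, llr μ ν z ∂μ : ℝ) : EReal) else ⊤

theorem rd_sum_coe {ι : Type*} (s : Finset ι) (f : ι → ℝ) :
    ∑ i ∈ s, ((f i : ℝ) : EReal) = ((∑ i ∈ s, f i : ℝ) : EReal) := by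
  classical
  induction s using Finset.induction_on with
  | empty => simp
  | insert a s ha ih => rw [Finset.sum_insert ha, Finset.sum_insert ha, ih, EReal.coe_add]

theorem rd_integrable {Z : Type*} [MeasurableSpace Z] (μ ν : Measure Z)
    [IsFiniteMeasure μ] [IsFiniteMeasure ν] (N : ℕ)
    (hle : μ ≤ (N : ℝ≥0∞) • ν) (hac : μ ≪ ν) : Integrable (llr μ ν) μ := by
  rw [← integrable_rnDeriv_mul_log_iff hac]
  have hb : μ.rnDeriv ν ≤ᵐ[ν] fun _ => (N : ℝ≥0∞) := by
    refine ae_le_of_forall_setLIntegral_le_of_sigmaFinite (μ.measurable_rnDeriv ν) fun s _ _ ↦ ?_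
    refine (Measure.setLIntegral_rnDeriv_le s).trans ((hle s).trans ?_)
    simp
  refine Integrable.of_bound (C := 1 + (N : ℝ) ^ 2) ?_ ?_
  · exact ((Measure.measurable_rnDeriv μ ν).ennreal_toReal.mul
      (Measure.measurable_rnDeriv μ ν).ennreal_toReal.log).aestronglyMeasurable
  · filter_upwards [hb] with x hx
    have h1 : (μ.rnDeriv ν x).toReal ≤ N := by
      have := ENNReal.toReal_mono (by simp) hx
      simpa using this
    have h0 : 0 ≤ (μ.rnDeriv ν x).toReal := ENNReal.toReal_nonneg
    generalize (μ.rnDeriv ν x).toReal = r at h0 h1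
    rcases h0.eq_or_lt with rfl | h0
    · simp; positivity
    · have a := Real.log_le_sub_one_of_pos h0
      have b := Real.one_sub_inv_le_log_of_pos h0
      have b' : r * (1 - r⁻¹) ≤ r * log r := by gcongr
      have e : r * (1 - r⁻¹) = r - 1 := by field_simp
      have a' : r * log r ≤ r * (r - 1) := by gcongr
      rw [Real.norm_eq_abs, abs_le]
      constructor <;> nlinarith

theorem rd_chain {Z : Type*} [MeasurableSpace Z] (μ ν p : Measure Z)
    [IsFiniteMeasure μ] [IsFiniteMeasure ν] [IsFiniteMeasure p]
    (h1 : μ ≪ ν) (h2 : ν ≪ p) : llr μ p =ᵐ[μ] fun x => llr μ ν x + llr ν p x := by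
  have h3 := h1.trans h2
  filter_upwards [h3.ae_le (Measure.rnDeriv_mul_rnDeriv (κ := p) h1), Measure.rnDeriv_pos h1,
    h1.ae_le (Measure.rnDeriv_pos h2), h1.ae_le (Measure.rnDeriv_lt_top μ ν),
    h3.ae_le (Measure.rnDeriv_lt_top ν p)] with x hx a b c d
  simp only [llr]
  rw [← hx, Pi.mul_apply, ENNReal.toReal_mul, Real.log_mul]
  · exact (ENNReal.toReal_pos a.ne' c.ne).ne'
  · exact (ENNReal.toReal_pos b.ne' d.ne).ne'

/-- Rate decomposition: the average KL divergence of the encoder distributions from the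
prior equals the mutual information term plus the KL divergence of the aggregate posterior
(uniform mixture) from the prior. -/
theorem rate_decomposition {Z : Type*} [MeasurableSpace Z] (N : ℕ) (hN : 0 < N)
    (μ : Fin N → Measure Z) [∀ n, IsProbabilityMeasure (μ n)]
    (p : Measure Z) [IsProbabilityMeasure p]
    (μbar : Measure Z) (hμbar : μbar = (N : ℝ≥0∞)⁻¹ • ∑ n, μ n)
    (hac : ∀ n, μ n ≪ p) (hfin : ∀ n, KL (μ n) p ≠ ⊤) :
    ((N : ℝ)⁻¹ : EReal) * ∑ n, KL (μ n) p
      = ((N : ℝ)⁻¹ : EReal) * ∑ n, KL (μ n) μbar + KL μbar p := by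
  have hN0 : (N : ℝ≥0∞) ≠ 0 := by simpa using hN.ne'
  have hNt : (N : ℝ≥0∞) ≠ ∞ := by simp
  have hNb : (N : ℝ≥0∞) • μbar = ∑ n, μ n := by
    rw [hμbar, smul_smul, ENNReal.mul_inv_cancel hN0 hNt, one_smul]
  have hfinb : IsFiniteMeasure μbar := by
    rw [hμbar]
    exact Measure.smul_finite _ (by simpa using hN.ne')
  have hle : ∀ n, μ n ≤ (N : ℝ≥0∞) • μbar := by
    intro n
    rw [hNb]
    exact Finset.single_le_sum (f := μ) (fun i _ => Measure.zero_le _) (Finset.mem_univ n)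
  have hab : ∀ n, μ n ≪ μbar := fun n =>
    (Measure.absolutelyContinuous_of_le (hle n)).trans Measure.smul_absolutelyContinuous
  have hbp : μbar ≪ p := by
    rw [hμbar]
    refine Measure.AbsolutelyContinuous.mk fun s _ hs => ?_
    simp [fun n => hac n hs]
  have hip : ∀ n, Integrable (llr (μ n) p) (μ n) := by
    intro n
    by_contra h
    exact hfin n (by simp [KL, h])
  have hib : ∀ n, Integrable (llr (μ n) μbar) (μ n) := fun n =>
    rd_integrable _ _ N (hle n) (hab n)
  have hch := fun n => rd_chain (μ n) μbar p (hab n) hbp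
  have hic : ∀ n, Integrable (llr μbar p) (μ n) := by
    intro n
    refine ((hip n).sub (hib n)).congr ?_
    filter_upwards [hch n] with x hx
    simp [hx]
  have hibp : Integrable (llr μbar p) μbar := by
    have : Integrable (llr μbar p) ((N : ℝ≥0∞)⁻¹ • ∑ n, μ n) := by
      refine Integrable.smul_measure ?_ (by simpa using hN.ne')
      exact integrable_finsetSum_measure.2 fun n _ => hic n
    rwa [← hμbar] at this
  have hint : ∫ z, llr μbar p z ∂μbar = (N : ℝ)⁻¹ * ∑ n, ∫ z, llr μbar p z ∂(μ n) := by
    have : ∀ f : Z → ℝ, (∀ n, Integrable f (μ n)) →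
        ∫ z, f z ∂μbar = (N : ℝ)⁻¹ * ∑ n, ∫ z, f z ∂(μ n) := by
      intro f hf
      rw [hμbar, integral_smul_measure, integral_finsetSum_measure fun n _ => hf n]
      simp
    exact this _ hic
  have hsum : ∀ n, ∫ z, llr (μ n) p z ∂(μ n)
      = ∫ z, llr (μ n) μbar z ∂(μ n) + ∫ z, llr μbar p z ∂(μ n) := by
    intro n
    rw [integral_congr_ae (hch n), integral_add (hib n) (hic n)]
  have k1 : ∀ n, KL (μ n) p = ((∫ z, llr (μ n) p z ∂(μ n) : ℝ) : EReal) := fun n =>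
    if_pos ⟨hac n, hip n⟩
  have k2 : ∀ n, KL (μ n) μbar = ((∫ z, llr (μ n) μbar z ∂(μ n) : ℝ) : EReal) := fun n =>
    if_pos ⟨hab n, hib n⟩
  have k3 : KL μbar p = ((∫ z, llr μbar p z ∂μbar : ℝ) : EReal) := if_pos ⟨hbp, hibp⟩
  simp only [k1, k2, k3, rd_sum_coe]
  rw [← EReal.coe_inv, ← EReal.coe_mul, ← EReal.coe_mul, ← EReal.coe_add, hint]
  congr 1
  simp only [hsum, Finset.sum_add_distrib, mul_add]
end

section
/- (Proposition 1 of the paper, Bernoulli likelihood specialization.) Fix a latent code z and let w_1, …, w_N be nonnegative reals with ∑_{n=1}^N w_n = 1 (the normalized encoder weights w_n(z) = q(z|x_n) / ∑_m q(z|x_m)), and let x_1, …, x_N ∈ [0, 1] be the training pixel values. Suppose the weighted average μ* = ∑_{n=1}^N w_n x_n satisfies 0 < μ* < 1. Then for every μ ∈ (0, 1), the weighted Bernoulli log-likelihood satisfies ∑_{n=1}^N w_n ( x_n log μ + (1 − x_n) log(1 − μ) ) ≤ ∑_{n=1}^N w_n ( x_n log μ* + (1 − x_n) log(1 − μ*)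 ), with equality if and only if μ = μ*. Hence the infinite-capacity optimal Bernoulli decoder outputs, at each latent code z, the weighted average of the training data with weights w_n(z). -/
open Finset

/-- Bernoulli specialization of Proposition 1 (Shu et al. 2018): the weighted Bernoulli
log-likelihood `∑ n, w n * (x n * log μ + (1 - x n) * log (1 - μ))` is maximized over
`μ ∈ (0,1)` exactly at the weighted average `μ* = ∑ n, w n * x n`. -/
theorem bernoulli_optimal_decoder_is_weighted_average
    (N : ℕ) (w : Fin N → ℝ) (hw_nonneg : ∀ n, 0 ≤ w n) (hw_sum : ∑ n, w n = 1)
    (x : Fin N → ℝ) (hx : ∀ n, x n ∈ Set.Icc (0 : ℝ) 1)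
    (μstar : ℝ) (hμstar : μstar = ∑ n, w n * x n)
    (hμstar_pos : 0 < μstar) (hμstar_lt : μstar < 1) :
    ∀ μ : ℝ, 0 < μ → μ < 1 →
      (∑ n, w n * (x n * Real.log μ + (1 - x n) * Real.log (1 - μ))
          ≤ ∑ n, w n * (x n * Real.log μstar + (1 - x n) * Real.log (1 - μstar))) ∧
      (∑ n, w n * (x n * Real.log μ + (1 - x n) * Real.log (1 - μ))
          = ∑ n, w n * (x n * Real.log μstar + (1 - x n) * Real.log (1 - μstar))
        ↔ μ = μstar) := by
  have key : ∀ a b : ℝ, ∑ n, w n * (x n * a + (1 - x n) * b) = μstar * a + (1 - μstar) * b := by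
    intro a b
    have h : ∀ n, w n * (x n * a + (1 - x n) * b) = (w n * x n) * a + (w n - w n * x n) * b := by
      intro n
      ring
    simp only [h]
    rw [Finset.sum_add_distrib, ← Finset.sum_mul, ← Finset.sum_mul, Finset.sum_sub_distrib,
      hw_sum, ← hμstar]
  intro μ h0 h1
  rw [key, key]
  have strict : μ ≠ μstar → μstar * Real.log μ + (1 - μstar) * Real.log (1 - μ)
      < μstar * Real.log μstar + (1 - μstar) * Real.log (1 - μstar) := by
    intro hne
    have h1' : 0 < 1 - μ := by linarith
    have h2' : 0 < 1 - μstar := by linarith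
    have hA : Real.log (μ / μstar) < μ / μstar - 1 := by
      apply Real.log_lt_sub_one_of_pos (by positivity)
      intro h
      rw [div_eq_one_iff_eq hμstar_pos.ne'] at h
      exact hne h
    have hB : Real.log ((1 - μ) / (1 - μstar)) ≤ (1 - μ) / (1 - μstar) - 1 :=
      Real.log_le_sub_one_of_pos (by positivity)
    rw [Real.log_div h0.ne' hμstar_pos.ne'] at hA
    rw [Real.log_div h1'.ne' h2'.ne'] at hB
    have hA2 := mul_lt_mul_of_pos_left hA hμstar_pos
    have hB2 := mul_le_mul_of_nonneg_left hB h2'.le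
    have eA : μstar * (μ / μstar - 1) = μ - μstar := by field_simp
    have eB : (1 - μstar) * ((1 - μ) / (1 - μstar) - 1) = μstar - μ := by
      rw [mul_sub, mul_div_cancel₀ _ h2'.ne']
      ring
    rw [eA] at hA2
    rw [eB] at hB2
    linarith
  by_cases h : μ = μstar
  · subst h
    simp
  · exact ⟨(strict h).le, fun e => absurd e (strict h).ne, fun e => absurd e h⟩
end
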